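/- Let n = 2m, N = 2^n − 1, and d_1, d_2 ∈ {1, …, N−1}. Suppose (j_1, j_2) ∈ 𝒥 satisfies j_1 + j_2 ≡ 0 (mod 2^m − 1), j_1 + j_2 ≠ N, and V_{d_1,d_2}(j_1, j_2) = m. Then wt_2(j_1) + wt_2(j_2) = wt_2(j_1 + j_2) = m and d_1 j_1 + d_2 j_2 ≡ 0 (mod N). -/

import Mathlib

open Finset

/-- `wt₂(j)`: the binary digit sum of the representative of `j mod N` in `{0, …, N−1}`. -/
def wt2 (N : ℕ) (j : ℤ) : ℕ := (Nat.digits 2 (j % (N : ℤ)).toNat).sum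

/-- `𝒥 = ({0,…,N−1} × {0,…,N−1}) \ {(0,0)}`. -/
def JJ (N : ℕ) : Finset (ℕ × ℕ) := ((Finset.range N) ×ˢ (Finset.range N)).erase (0, 0)

/-- `V_{d₁,d₂}(j₁,j₂) = wt₂(j₁) + wt₂(j₂) + wt₂(−d₁j₁ − d₂j₂)`. -/
def Vfun (N d₁ d₂ : ℕ) (p : ℕ × ℕ) : ℕ :=
  wt2 N (p.1 : ℤ) + wt2 N (p.2 : ℤ) + wt2 N (-((d₁ : ℤ) * p.1 + (d₂ : ℤ) * p.2))

theorem binary_digitSum_two_mul (a : ℕ) :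
    (Nat.digits 2 (2 * a)).sum = (Nat.digits 2 a).sum := by
  rcases Nat.eq_zero_or_pos a with rfl | ha
  · simp
  · rw [Nat.digits_def' (by norm_num) (by omega)]
    simp

theorem binary_digitSum_two_mul_add_one (a : ℕ) :
    (Nat.digits 2 (2 * a + 1)).sum = (Nat.digits 2 a).sum + 1 := by
  rw [Nat.digits_def' (by norm_num) (by omega), show (2 * a + 1) % 2 = 1 by omega,
    show (2 * a + 1) / 2 = a by omega, List.sum_cons, add_comm]

/-- Splitting off the lowest binary digit. -/
theorem binary_digitSum_eq_mod_add_div (a : ℕ) :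
    (Nat.digits 2 a).sum = a % 2 + (Nat.digits 2 (a / 2)).sum := by
  rcases Nat.eq_zero_or_pos a with rfl | ha
  · simp
  · conv_lhs => rw [Nat.digits_def' (by norm_num) ha]
    rw [List.sum_cons]

theorem eq_zero_of_binary_digitSum_eq_zero (a : ℕ) (h : (Nat.digits 2 a).sum = 0) : a = 0 := by
  induction a using Nat.strong_induction_on with
  | _ a ih =>
    rw [binary_digitSum_eq_mod_add_div] at h
    by_contra ha
    have := ih (a / 2) (by omega) (by omega)
    omega

theorem binary_digitSum_succ_le (a : ℕ) :
    (Nat.digits 2 (a + 1)).sum ≤ (Nat.digits 2 a).sum + 1 := by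
  induction a using Nat.strong_induction_on with
  | _ a ih =>
    obtain ⟨k, rfl | rfl⟩ := Nat.even_or_odd' a
    · rw [binary_digitSum_two_mul_add_one, binary_digitSum_two_mul]
    · have := ih k (by omega)
      rw [show 2 * k + 1 + 1 = 2 * (k + 1) by ring, binary_digitSum_two_mul,
        binary_digitSum_two_mul_add_one]
      omega

theorem binary_digitSum_add_le (a b : ℕ) :
    (Nat.digits 2 (a + b)).sum ≤ (Nat.digits 2 a).sum + (Nat.digits 2 b).sum := by
  induction a using Nat.strong_induction_on generalizing b with
  | _ a ih =>
    rcases Nat.eq_zero_or_pos a with rfl | ha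
    · simp
    have h := ih (a / 2) (by omega) (b / 2)
    have hs := binary_digitSum_succ_le (a / 2 + b / 2)
    rw [binary_digitSum_eq_mod_add_div (a + b), binary_digitSum_eq_mod_add_div a,
      binary_digitSum_eq_mod_add_div b]
    by_cases hc : a % 2 + b % 2 = 2
    · rw [show (a + b) / 2 = a / 2 + b / 2 + 1 by omega]
      omega
    · rw [show (a + b) / 2 = a / 2 + b / 2 by omega]
      omega

theorem binary_digitSum_two_pow_mul_add (k q r : ℕ) (hr : r < 2 ^ k) :
    (Nat.digits 2 (2 ^ k * q + r)).sum = (Nat.digits 2 q).sum + (Nat.digits 2 r).sum := by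
  induction k generalizing r with
  | zero =>
    obtain rfl : r = 0 := by simpa using hr
    simp
  | succ k ih =>
    have h := ih (r / 2) (by rw [pow_succ] at hr; omega)
    have e : 2 ^ (k + 1) * q + r = 2 * (2 ^ k * q) + r := by ring
    rw [e, binary_digitSum_eq_mod_add_div, binary_digitSum_eq_mod_add_div r,
      show (2 * (2 ^ k * q) + r) / 2 = 2 ^ k * q + r / 2 by omega, h]
    omega

/-- Binary complements of length `k` have digit sums adding up to `k`. -/
theorem binary_digitSum_add_of_add_eq (k a b : ℕ) (h : a + b + 1 = 2 ^ k) :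
    (Nat.digits 2 a).sum + (Nat.digits 2 b).sum = k := by
  induction k generalizing a b with
  | zero =>
    obtain ⟨rfl, rfl⟩ : a = 0 ∧ b = 0 := by simpa using h
    simp
  | succ k ih =>
    rw [pow_succ] at h
    have := ih (a / 2) (b / 2) (by omega)
    rw [binary_digitSum_eq_mod_add_div a, binary_digitSum_eq_mod_add_div b]
    omega

/-- A positive multiple of `2 ^ m - 1` below `2 ^ (2 * m) - 1` has binary digit sum `m`. -/
theorem binary_digitSum_of_two_pow_sub_one_dvd (m r : ℕ) (hr : 0 < r)
    (hlt : r < 2 ^ (2 * m) - 1) (hdvd : 2 ^ m - 1 ∣ r) : (Nat.digits 2 r).sum = m := by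
  obtain ⟨k, rfl⟩ := hdvd
  obtain ⟨M, hM⟩ : ∃ M, 2 ^ m = M + 1 := ⟨2 ^ m - 1, by have := Nat.one_le_two_pow (n := m); omega⟩
  have hk : 0 < k := Nat.pos_of_mul_pos_left hr
  have hsq : 2 ^ (2 * m) - 1 = M * (M + 2) := by
    rw [mul_comm 2 m, pow_mul, hM]
    apply Nat.sub_eq_of_eq_add
    ring
  rw [hsq, hM, Nat.add_sub_cancel] at hlt
  have hk' : k < M + 2 := lt_of_mul_lt_mul_left hlt (Nat.zero_le M)
  obtain ⟨a, rfl⟩ : ∃ a, k = a + 1 := ⟨k - 1, by omega⟩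
  obtain ⟨b, rfl⟩ : ∃ b, M = a + b := ⟨M - a, by omega⟩
  have e : (2 ^ m - 1) * (a + 1) = 2 ^ m * a + b := by
    rw [hM, Nat.add_sub_cancel]
    ring
  rw [e, binary_digitSum_two_pow_mul_add m a b (by omega)]
  exact binary_digitSum_add_of_add_eq m a b hM.symm

/-- Reduction modulo `2 ^ n - 1` does not increase the binary digit sum of a number
below `2 * (2 ^ n - 1)`. -/
theorem binary_digitSum_mod_le (n s : ℕ) (hs : s < 2 * (2 ^ n - 1)) :
    (Nat.digits 2 (s % (2 ^ n - 1))).sum ≤ (Nat.digits 2 s).sum := by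
  rcases lt_trichotomy s (2 ^ n - 1) with h | h | h
  · rw [Nat.mod_eq_of_lt h]
  · simp [h]
  · obtain ⟨t, rfl⟩ : ∃ t, s = 2 ^ n * 1 + t := ⟨s - 2 ^ n, by omega⟩
    have e : (2 ^ n * 1 + t) % (2 ^ n - 1) = t + 1 := by
      rw [Nat.mod_eq_sub_mod h.le, Nat.mod_eq_of_lt (by omega)]
      omega
    rw [e, binary_digitSum_two_pow_mul_add n 1 t (by omega)]
    have := binary_digitSum_succ_le t
    have h1 : (Nat.digits 2 1).sum = 1 := by simp
    omega

theorem wt2_natCast (N j : ℕ) : wt2 N (j : ℤ) = (Nat.digits 2 (j % N)).sum := by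
  rw [wt2, ← Int.natCast_mod, Int.toNat_natCast]

theorem dvd_of_wt2_eq_zero (N : ℕ) (hN : 0 < N) (j : ℤ) (h : wt2 N j = 0) : (N : ℤ) ∣ j := by
  have h0 := eq_zero_of_binary_digitSum_eq_zero _ h
  have h1 := Int.emod_nonneg j (b := (N : ℤ)) (by omega)
  exact Int.dvd_of_emod_eq_zero (by omega)

/-- Let `n = 2m`, `N = 2^n − 1`, `d₁, d₂ ∈ {1, …, N−1}`.  Suppose `(j₁, j₂) ∈ 𝒥` satisfies
`j₁ + j₂ ≡ 0 (mod 2^m − 1)`, `j₁ + j₂ ≠ N`, and `V_{d₁,d₂}(j₁, j₂) = m`.  Then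
`wt₂(j₁) + wt₂(j₂) = wt₂(j₁ + j₂) = m` and `d₁j₁ + d₂j₂ ≡ 0 (mod N)`. -/
theorem stmt6 (m n : ℕ) (hm : 0 < m) (hn : n = 2 * m) (N : ℕ) (hN : N = 2 ^ n - 1)
    (d₁ d₂ : ℕ) (hd₁ : 1 ≤ d₁) (hd₁' : d₁ ≤ N - 1) (hd₂ : 1 ≤ d₂) (hd₂' : d₂ ≤ N - 1)
    (p : ℕ × ℕ) (hp : p ∈ JJ N)
    (hmod : (2 ^ m - 1) ∣ (p.1 + p.2)) (hne : p.1 + p.2 ≠ N)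
    (hV : Vfun N d₁ d₂ p = m) :
    wt2 N (p.1 : ℤ) + wt2 N (p.2 : ℤ) = m ∧
    wt2 N ((p.1 : ℤ) + (p.2 : ℤ)) = m ∧
    (N : ℤ) ∣ ((d₁ : ℤ) * p.1 + (d₂ : ℤ) * p.2) := by
  obtain ⟨a, b⟩ := p
  simp only [JJ, Finset.mem_erase, Finset.mem_product, Finset.mem_range, ne_eq,
    Prod.mk.injEq] at hp
  obtain ⟨h0, ha, hb⟩ := hp
  simp only [Vfun] at hV hmod hne ⊢
  have hab : wt2 N ((a : ℤ) + (b : ℤ)) = (Nat.digits 2 ((a + b) % N)).sum := by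
    rw [← Nat.cast_add, wt2_natCast]
  have hle : wt2 N ((a : ℤ) + (b : ℤ)) ≤ wt2 N (a : ℤ) + wt2 N (b : ℤ) := by
    rw [hab, wt2_natCast, wt2_natCast, Nat.mod_eq_of_lt ha, Nat.mod_eq_of_lt hb]
    refine le_trans ?_ (binary_digitSum_add_le a b)
    rw [hN]
    exact binary_digitSum_mod_le n (a + b) (by omega)
  have hwt : wt2 N ((a : ℤ) + (b : ℤ)) = m := by
    rw [hab]
    have hNdvd : 2 ^ m - 1 ∣ N := by
      rw [hN, hn]
      exact Nat.pow_sub_one_dvd_pow_sub_one 2 (Dvd.intro_left 2 rfl)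
    refine binary_digitSum_of_two_pow_sub_one_dvd m _ ?_ ?_ ((Nat.dvd_mod_iff hNdvd).2 hmod)
    · rcases lt_or_ge (a + b) N with h | h
      · rw [Nat.mod_eq_of_lt h]
        omega
      · rw [Nat.mod_eq_sub_mod h, Nat.mod_eq_of_lt (by omega)]
        omega
    · rw [← hn, ← hN]
      exact Nat.mod_lt _ (by omega)
  refine ⟨by omega, hwt, ?_⟩
  exact (dvd_neg).1 (dvd_of_wt2_eq_zero N (by omega) _ (by omega))
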